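/- arXiv:2006.07941 — 2 statements merged into one kernel-verified Lean document; each statement's English description precedes it below -/
import Mathlib

section
/- Let X be a Poisson random variable with mean m > 0, let a be a real number, and let b ≥ 0 be a real number. Then for every integer r ≥ 1, D(r,a,b) = m·D(r-1, a-1, b-1) − a·D(r-1, a, b). -/
/-- The Poisson probability mass at `j` for a Poisson distribution with mean `m`:
`P(X = j) = e^{-m} m^j / j!`. -/
noncomputable def poissonWeight (m : ℝ) (j : ℕ) : ℝ :=
  Real.exp (-m) * m ^ j / (Nat.factorial j : ℝ)

/-- `sgn y = -1` if `y ≤ 0` and `1` if `y > 0`. -/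
noncomputable def sgn (y : ℝ) : ℝ := if y ≤ 0 then -1 else 1

/-- `momD m a b r = E[(X - a)^r · sign(X - b)]` for a Poisson random variable `X`
with mean `m` (with the convention `0^0 = 1`). -/
noncomputable def momD (m a b : ℝ) (r : ℕ) : ℝ :=
  ∑' j : ℕ, ((j : ℝ) - a) ^ r * sgn ((j : ℝ) - b) * poissonWeight m j

theorem abs_sgn (y : ℝ) : |sgn y| = 1 := by
  unfold sgn
  split_ifs <;> simp

theorem succ_mul_poissonWeight_succ (m : ℝ) (j : ℕ) :
    ((j : ℝ) + 1) * poissonWeight m (j + 1) = m * poissonWeight m j := by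
  have hj : (Nat.factorial j : ℝ) ≠ 0 := by positivity
  have hj' : (j : ℝ) + 1 ≠ 0 := by positivity
  unfold poissonWeight
  rw [Nat.factorial_succ]
  push_cast
  field_simp
  ring

theorem abs_natCast_sub_pow_le (a : ℝ) (s j : ℕ) :
    |(j : ℝ) - a| ^ s ≤ s.factorial * Real.exp |a| * Real.exp 1 ^ j := by
  have hs : (0 : ℝ) < s.factorial := by positivity
  have h := Real.pow_div_factorial_le_exp |(j : ℝ) - a| (abs_nonneg _) s
  rw [div_le_iff₀ hs] at h
  have htri : |(j : ℝ) - a| ≤ |a| + j := by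
    simpa [add_comm] using abs_sub (j : ℝ) a
  calc |(j : ℝ) - a| ^ s ≤ Real.exp |(j : ℝ) - a| * s.factorial := h
    _ ≤ Real.exp (|a| + j) * s.factorial := by gcongr
    _ = s.factorial * Real.exp |a| * Real.exp 1 ^ j := by
      rw [Real.exp_add, Real.exp_one_pow]
      ring

theorem summable_momD (m a b : ℝ) (s : ℕ) :
    Summable fun j : ℕ ↦ ((j : ℝ) - a) ^ s * sgn ((j : ℝ) - b) * poissonWeight m j := by
  refine Summable.of_norm_bounded
    ((Real.summable_pow_div_factorial (Real.exp 1 * |m|)).mul_left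
      (s.factorial * Real.exp |a| * Real.exp (-m))) fun j ↦ ?_
  have hw : |poissonWeight m j| = Real.exp (-m) * |m| ^ j / j.factorial := by
    simp [poissonWeight, abs_div, abs_mul, abs_pow]
  rw [Real.norm_eq_abs, abs_mul, abs_mul, abs_pow, abs_sgn, mul_one, hw]
  calc |(j : ℝ) - a| ^ s * (Real.exp (-m) * |m| ^ j / j.factorial)
      ≤ (s.factorial * Real.exp |a| * Real.exp 1 ^ j) *
          (Real.exp (-m) * |m| ^ j / j.factorial) := by
        gcongr
        exact abs_natCast_sub_pow_le a s j
    _ = _ := by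
        rw [mul_pow]
        ring

/-- For a Poisson random variable with mean `m > 0`, real `a` and real `b ≥ 0`,
for every integer `r ≥ 1`: `D(r,a,b) = m·D(r-1, a-1, b-1) − a·D(r-1, a, b)`. -/
theorem poisson_signed_moment_shift
    (m : ℝ) (hm : 0 < m) (a b : ℝ) (hb : 0 ≤ b) (r : ℕ) (hr : 1 ≤ r) :
    momD m a b r = m * momD m (a - 1) (b - 1) (r - 1) - a * momD m a b (r - 1) := by
  obtain ⟨s, rfl⟩ := Nat.exists_eq_add_of_le' hr
  rw [Nat.add_sub_cancel]
  let f (j : ℕ) : ℝ := j * (((j : ℝ) - a) ^ s * sgn ((j : ℝ) - b) * poissonWeight m j)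
  have hsplit (j : ℕ) : ((j : ℝ) - a) ^ (s + 1) * sgn ((j : ℝ) - b) * poissonWeight m j =
      f j - a * (((j : ℝ) - a) ^ s * sgn ((j : ℝ) - b) * poissonWeight m j) := by
    simp only [f]
    ring
  have hf : Summable f := by
    refine ((summable_momD m a b (s + 1)).add ((summable_momD m a b s).mul_left a)).congr
      fun j ↦ ?_
    rw [hsplit]
    ring
  have hshift (j : ℕ) : f (j + 1) =
      m * (((j : ℝ) - (a - 1)) ^ s * sgn ((j : ℝ) - (b - 1)) * poissonWeight m j) := by
    simp only [f]
    push_cast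
    rw [show (j : ℝ) - (a - 1) = j + 1 - a by ring, show (j : ℝ) - (b - 1) = j + 1 - b by ring]
    linear_combination
      ((j : ℝ) + 1 - a) ^ s * sgn ((j : ℝ) + 1 - b) * succ_mul_poissonWeight_succ m j
  have hf0 : f 0 = 0 := by simp [f]
  unfold momD
  rw [tsum_congr hsplit, hf.tsum_sub ((summable_momD m a b s).mul_left a), hf.tsum_eq_zero_add,
    hf0, zero_add, tsum_congr hshift, tsum_mul_left, tsum_mul_left]
end

section
/- Let X be a Poisson random variable with mean m > 0, let a be a real number, let b ≥ 0 be a real number, and let r ≥ 1 be an integer. Then e^m·D(r,a,b) = Σ_{j=0}^{∞} (j+1−a)^{r-1}·sign(j+1−b)·m^{j+1}/j! − a·e^m·D(r-1,a,b). -/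
theorem summable_pow_mul_sgn_mul_pow_div_factorial (m a b : ℝ) (r : ℕ) :
    Summable fun j : ℕ ↦
      ((j : ℝ) - a) ^ r * sgn ((j : ℝ) - b) * (m ^ j / (Nat.factorial j : ℝ)) := by
  refine Summable.of_norm_bounded
    (g := fun j : ℕ ↦ (Nat.factorial r * Real.exp |a|) *
      ((Real.exp 1 * |m|) ^ j / (Nat.factorial j : ℝ)))
    ((Real.summable_pow_div_factorial _).mul_left _) fun j ↦ ?_
  have h_pow : |(j : ℝ) - a| ^ r ≤ Nat.factorial r * Real.exp |(j : ℝ) - a| := by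
    have h := Real.pow_div_factorial_le_exp |(j : ℝ) - a| (abs_nonneg _) r
    rwa [div_le_iff₀' (by positivity)] at h
  have h_exp : Real.exp |(j : ℝ) - a| ≤ Real.exp |a| * Real.exp 1 ^ j := by
    rw [← Real.exp_nat_mul, ← Real.exp_add, Real.exp_le_exp]
    have h := abs_sub (j : ℝ) a
    rw [Nat.abs_cast] at h
    linarith
  rw [Real.norm_eq_abs, abs_mul, abs_mul, abs_sgn, abs_pow, abs_div, abs_pow, Nat.abs_cast, mul_one]
  calc |(j : ℝ) - a| ^ r * (|m| ^ j / (Nat.factorial j : ℝ))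
      ≤ Nat.factorial r * (Real.exp |a| * Real.exp 1 ^ j) *
          (|m| ^ j / (Nat.factorial j : ℝ)) := by
        gcongr
        exact h_pow.trans (by gcongr)
    _ = _ := by ring

theorem exp_mul_momD (m a b : ℝ) (r : ℕ) :
    Real.exp m * momD m a b r =
      ∑' j : ℕ, ((j : ℝ) - a) ^ r * sgn ((j : ℝ) - b) * (m ^ j / (Nat.factorial j : ℝ)) := by
  rw [momD, ← tsum_mul_left]
  refine tsum_congr fun j ↦ ?_
  have h : Real.exp m * Real.exp (-m) = 1 := by simp [← Real.exp_add]
  rw [poissonWeight]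
  linear_combination
    (((j : ℝ) - a) ^ r * sgn ((j : ℝ) - b) * (m ^ j / (Nat.factorial j : ℝ))) * h

/-- For a Poisson random variable with mean `m > 0`, real `a`, real `b ≥ 0` and
integer `r ≥ 1`:
`e^m·D(r,a,b) = Σ_{j=0}^{∞} (j+1−a)^{r-1}·sign(j+1−b)·m^{j+1}/j! − a·e^m·D(r-1,a,b)`. -/
theorem poisson_signed_moment_shift_series
    (m : ℝ) (hm : 0 < m) (a b : ℝ) (hb : 0 ≤ b) (r : ℕ) (hr : 1 ≤ r) :
    Real.exp m * momD m a b r =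
      (∑' j : ℕ, ((j : ℝ) + 1 - a) ^ (r - 1) * sgn ((j : ℝ) + 1 - b) *
        m ^ (j + 1) / (Nat.factorial j : ℝ)) -
      a * Real.exp m * momD m a b (r - 1) := by
  obtain ⟨s, rfl⟩ : ∃ s, r = s + 1 := ⟨r - 1, by omega⟩
  rw [Nat.add_sub_cancel, mul_assoc, exp_mul_momD, exp_mul_momD, eq_sub_iff_add_eq,
    ← tsum_mul_left]
  have h₁ := summable_pow_mul_sgn_mul_pow_div_factorial m a b (s + 1)
  have h₀ := (summable_pow_mul_sgn_mul_pow_div_factorial m a b s).mul_left a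
  rw [← h₁.tsum_add h₀, (h₁.add h₀).tsum_eq_zero_add]
  have h_zero : (((0 : ℕ) : ℝ) - a) ^ (s + 1) * sgn (((0 : ℕ) : ℝ) - b) *
        (m ^ 0 / (Nat.factorial 0 : ℝ)) +
      a * ((((0 : ℕ) : ℝ) - a) ^ s * sgn (((0 : ℕ) : ℝ) - b) *
        (m ^ 0 / (Nat.factorial 0 : ℝ))) = 0 := by
    push_cast
    ring
  rw [h_zero, zero_add]
  refine tsum_congr fun j ↦ ?_
  rw [Nat.factorial_succ]
  push_cast
  have hj : (j : ℝ) + 1 ≠ 0 := by positivity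
  have hf : (Nat.factorial j : ℝ) ≠ 0 := by positivity
  field_simp
  ring
end
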